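/- arXiv:1712.04208 — 3 statements merged into one kernel-verified Lean document; each statement's English description precedes it below -/
import Mathlib

section
/- Let a ≥ 0, b ≥ 1, let 𝕂 ∈ {ℝ, ℂ}, and let E ⊆ ⋃_{n≥1} B_n^{a,b} be an identity block. Then for every 1 ≤ p ≤ ∞ the sequence (α_{p,n}(E))_{n=1}^∞ is submultiplicative, i.e. α_{p,mn}(E) ≤ α_{p,m}(E)·α_{p,n}(E) for all m, n ∈ ℕ. -/
open scoped BigOperators ENNReal

noncomputable section

namespace AsymSeminorms

variable {𝕜 : Type*} [RCLike 𝕜]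

/-- A pair of seminorms on `𝕜^n`, used to encode a (finite) basic sequence together with
the seminorm induced by an operator. -/
abbrev SNPair (𝕜 : Type*) [RCLike 𝕜] (n : ℕ) : Type _ :=
  Seminorm 𝕜 (Fin n → 𝕜) × Seminorm 𝕜 (Fin n → 𝕜)

/-- Truncation of a vector in `𝕜^n` to its first `m` coordinates (the rest set to `0`);
this encodes `∑_{i=1}^m a_i e_i`. -/
def trunc {n : ℕ} (m : ℕ) (a : Fin n → 𝕜) : Fin n → 𝕜 :=
  fun i => if (i : ℕ) < m then a i else 0

/-- Membership in the set `B_n^{a,b}` (here the constants are called `ca`, `cb`):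
`r = P.1` is a norm with `r(e_i) = 1`, both seminorms satisfy the `b`-basis inequality for
truncations, and `ρ = P.2` satisfies `ρ ≤ a·r`. -/
structure MemB (ca cb : ℝ) {n : ℕ} (P : SNPair 𝕜 n) : Prop where
  eq_zero_of : ∀ x : Fin n → 𝕜, P.1 x = 0 → x = 0
  single_eq_one : ∀ i : Fin n, P.1 (Pi.single i 1) = 1
  trunc_fst : ∀ m : ℕ, m ≤ n → ∀ a : Fin n → 𝕜, P.1 (trunc m a) ≤ cb * P.1 a
  trunc_snd : ∀ m : ℕ, m ≤ n → ∀ a : Fin n → 𝕜, P.2 (trunc m a) ≤ cb * P.2 a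
  snd_le : ∀ x : Fin n → 𝕜, P.2 x ≤ ca * P.1 x

/-- The metric `d_n` on `B_n^{a,b}`: the supremum, over coefficient vectors in the unit ball
of `ℓ_∞^n`, of the maximal deviation of the two seminorms. -/
def dB {n : ℕ} (P Q : SNPair 𝕜 n) : ℝ :=
  sSup {x : ℝ | ∃ a : Fin n → 𝕜, (∀ i, ‖a i‖ ≤ 1) ∧
      x = max |P.1 a - Q.1 a| |P.2 a - Q.2 a|}

/-- A family `E`, with `E n` a set of pairs of seminorms on `𝕜^n`; this encodes a subset of
`⋃_{n≥1} B_n^{a,b}`. -/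
abbrev Fam (𝕜 : Type*) [RCLike 𝕜] : Type _ := ∀ n : ℕ, Set (SNPair 𝕜 n)

/-- `E ⊆ ⋃_n B_n^{a,b}`. -/
def SubB (ca cb : ℝ) (E : Fam 𝕜) : Prop := ∀ n, ∀ P ∈ E n, MemB ca cb P

/-- `E` is closed: each `E ∩ B_n^{a,b}` is closed in `B_n^{a,b}` for the metric `d_n`. -/
def ClosedFam (ca cb : ℝ) (E : Fam 𝕜) : Prop :=
  ∀ n, ∀ P : SNPair 𝕜 n, MemB ca cb P →
    (∀ ε : ℝ, 0 < ε → ∃ Q ∈ E n, dB P Q < ε) → P ∈ E n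

/-- The `j`-th block piece: the vector `∑_{k_j < i ≤ k_{j+1}} a_i e_i` (with `0`-based
indexing of the cut points `k`). -/
def piece {n m : ℕ} (a : Fin n → 𝕜) (k : Fin (m + 1) → ℕ) (j : Fin m) : Fin n → 𝕜 :=
  fun i => if k j.castSucc ≤ (i : ℕ) ∧ (i : ℕ) < k j.succ then a i else 0

/-- `(s,σ) = Q` is a block of `(r,ρ) = P`. -/
def IsBlockOf {n m : ℕ} (P : SNPair 𝕜 n) (Q : SNPair 𝕜 m) : Prop :=
  ∃ (a : Fin n → 𝕜) (k : Fin (m + 1) → ℕ),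
    k 0 = 0 ∧ StrictMono k ∧ k (Fin.last m) ≤ n ∧
    (∀ j : Fin m, P.1 (piece a k j) = 1) ∧
    (∀ b : Fin m → 𝕜, Q.1 b = P.1 (∑ j : Fin m, b j • piece a k j)) ∧
    (∀ b : Fin m → 𝕜, Q.2 b = P.2 (∑ j : Fin m, b j • piece a k j))

/-- `E` contains all blocks of its members (that lie in the corresponding `B_m^{a,b}`). -/
def BlockClosedFam (ca cb : ℝ) (E : Fam 𝕜) : Prop :=
  ∀ n m : ℕ, ∀ P ∈ E n, ∀ Q : SNPair 𝕜 m, MemB ca cb Q → IsBlockOf P Q → Q ∈ E m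

/-- `E ⊆ ⋃_n B_n^{a,b}` is stable: closed and block closed. -/
def StableFam (ca cb : ℝ) (E : Fam 𝕜) : Prop :=
  SubB ca cb E ∧ ClosedFam ca cb E ∧ BlockClosedFam ca cb E

/-- `E` is an identity block: stable and `r = ρ` for each member. -/
def IdentityBlockFam (ca cb : ℝ) (E : Fam 𝕜) : Prop :=
  StableFam ca cb E ∧ ∀ n, ∀ P ∈ E n, P.1 = P.2

/-- The `ℓ_p^n` norm of a coefficient vector, `1 ≤ p ≤ ∞`. -/
def lpnorm (p : ℝ≥0∞) {n : ℕ} (a : Fin n → 𝕜) : ℝ :=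
  if p = ∞ then ⨆ i, ‖a i‖ else (∑ i, ‖a i‖ ^ p.toReal) ^ (1 / p.toReal)

/-- The sign `±1 ∈ 𝕜` associated to a Boolean. -/
def sgn (b : Bool) : 𝕜 := if b then 1 else -1

/-- The `L_p` norm of a real function of `n` independent Rademacher variables, i.e. of a
function on `{±1}^n` with the uniform probability measure. -/
def radLp (p : ℝ≥0∞) {n : ℕ} (F : (Fin n → Bool) → ℝ) : ℝ :=
  if p = ∞ then ⨆ ε : Fin n → Bool, |F ε|
  else ((∑ ε : Fin n → Bool, |F ε| ^ p.toReal) / 2 ^ n) ^ (1 / p.toReal)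

/-- `α_{p,n}(E)`: the infimum of the constants `T > 0` such that
`ρ(∑ a_i e_i) ≤ T ‖(a_i)‖_{ℓ_p^n}` for all `(r,ρ) ∈ E ∩ B_n^{a,b}`. -/
def alphaC (p : ℝ≥0∞) (E : Fam 𝕜) (n : ℕ) : ℝ :=
  sInf {T : ℝ | 0 < T ∧ ∀ P ∈ E n, ∀ a : Fin n → 𝕜, P.2 a ≤ T * lpnorm p a}

/-- `β_{q,n}(E)`: the infimum of the constants `C > 0` such that
`C r(∑ a_i e_i) ≥ ‖(a_i ρ(e_i))‖_{ℓ_q^n}` for all `(r,ρ) ∈ E ∩ B_n^{a,b}`. -/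
def betaC (q : ℝ≥0∞) (E : Fam 𝕜) (n : ℕ) : ℝ :=
  sInf {C : ℝ | 0 < C ∧ ∀ P ∈ E n, ∀ a : Fin n → 𝕜,
    lpnorm q (fun i => a i * ((P.2 (Pi.single i 1) : ℝ) : 𝕜)) ≤ C * P.1 a}

/-- `τ_{p,n}(E)`: the infimum of the constants `T > 0` such that
`‖ρ(∑ ε_i a_i e_i)‖_{L_p} ≤ T ‖(a_i)‖_{ℓ_p^n}` for all `(r,ρ) ∈ E ∩ B_n^{a,b}`. -/
def tauC (p : ℝ≥0∞) (E : Fam 𝕜) (n : ℕ) : ℝ :=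
  sInf {T : ℝ | 0 < T ∧ ∀ P ∈ E n, ∀ a : Fin n → 𝕜,
    radLp p (fun ε => P.2 (fun i => sgn (ε i) * a i)) ≤ T * lpnorm p a}

/-- `γ_{q,n}(E)`: the infimum of the constants `C > 0` such that
`C ‖r(∑ ε_i a_i e_i)‖_{L_q} ≥ ‖(a_i ρ(e_i))‖_{ℓ_q^n}` for all `(r,ρ) ∈ E ∩ B_n^{a,b}`. -/
def gammaC (q : ℝ≥0∞) (E : Fam 𝕜) (n : ℕ) : ℝ :=
  sInf {C : ℝ | 0 < C ∧ ∀ P ∈ E n, ∀ a : Fin n → 𝕜,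
    lpnorm q (fun i => a i * ((P.2 (Pi.single i 1) : ℝ) : 𝕜)) ≤
      C * radLp q (fun ε => P.1 (fun i => sgn (ε i) * a i))}

/-- `θ_n(E)`: the infimum of the constants `T > 0` such that
`ρ((1/n) ∑ a_i e_i) ≤ T ‖(a_i)‖_{ℓ_∞^n}` for all `(r,ρ) ∈ E ∩ B_n^{a,b}`. -/
def thetaC (E : Fam 𝕜) (n : ℕ) : ℝ :=
  sInf {T : ℝ | 0 < T ∧ ∀ P ∈ E n, ∀ a : Fin n → 𝕜,
    P.2 ((n : 𝕜)⁻¹ • a) ≤ T * lpnorm ∞ a}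

/-- `Θ_n(E)`: the infimum of the constants `T > 0` such that
`‖ρ((1/n) ∑ ε_i a_i e_i)‖_{L_1} ≤ T ‖(a_i)‖_{ℓ_∞^n}` for all `(r,ρ) ∈ E ∩ B_n^{a,b}`. -/
def bigThetaC (E : Fam 𝕜) (n : ℕ) : ℝ :=
  sInf {T : ℝ | 0 < T ∧ ∀ P ∈ E n, ∀ a : Fin n → 𝕜,
    radLp 1 (fun ε => P.2 ((n : 𝕜)⁻¹ • fun i => sgn (ε i) * a i)) ≤ T * lpnorm ∞ a}

/-- `υ_n(E)`: the infimum of the constants `C > 0` such that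
`C r(∑ a_i e_i) ≥ min_i |a_i| ρ(e_i)` for all `(r,ρ) ∈ E ∩ B_n^{a,b}`. -/
def upsC (E : Fam 𝕜) (n : ℕ) : ℝ :=
  sInf {C : ℝ | 0 < C ∧ ∀ P ∈ E n, ∀ a : Fin n → 𝕜,
    (⨅ i, ‖a i‖ * P.2 (Pi.single i 1)) ≤ C * P.1 a}

/-- `Υ_n(E)`: the infimum of the constants `C > 0` such that
`C ‖r(∑ ε_i a_i e_i)‖_{L_1} ≥ min_i |a_i| ρ(e_i)` for all `(r,ρ) ∈ E ∩ B_n^{a,b}`. -/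
def bigUpsC (E : Fam 𝕜) (n : ℕ) : ℝ :=
  sInf {C : ℝ | 0 < C ∧ ∀ P ∈ E n, ∀ a : Fin n → 𝕜,
    (⨅ i, ‖a i‖ * P.2 (Pi.single i 1)) ≤
      C * radLp 1 (fun ε => P.1 (fun i => sgn (ε i) * a i))}

end AsymSeminorms

namespace AsymSeminorms

section

variable {𝕜 : Type*} [RCLike 𝕜]

/-- The linear map sending the canonical basis to the block pieces. -/
def blockMap {n m : ℕ} (a : Fin n → 𝕜) (k : Fin (m + 1) → ℕ) : (Fin m → 𝕜) →ₗ[𝕜] (Fin n → 𝕜) :=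
  Fintype.linearCombination 𝕜 (piece a k)

theorem blockMap_apply {n m : ℕ} (a : Fin n → 𝕜) (k : Fin (m + 1) → ℕ) (b : Fin m → 𝕜) :
    blockMap a k b = ∑ j, b j • piece a k j := rfl

theorem blockMap_single {n m : ℕ} (a : Fin n → 𝕜) (k : Fin (m + 1) → ℕ) (j : Fin m) :
    blockMap a k (Pi.single j 1) = piece a k j := by
  simp [blockMap]

theorem blockMap_apply_of_mem {n m : ℕ} (a : Fin n → 𝕜) {k : Fin (m + 1) → ℕ} (hk : StrictMono k)
    (b : Fin m → 𝕜) {j : Fin m} {i : Fin n} (h₁ : k j.castSucc ≤ i) (h₂ : (i : ℕ) < k j.succ) :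
    blockMap a k b i = b j * a i := by
  rw [blockMap_apply, Finset.sum_apply, Finset.sum_eq_single j]
  · simp [piece, h₁, h₂]
  · intro l _ hl
    have : ¬ (k l.castSucc ≤ (i : ℕ) ∧ (i : ℕ) < k l.succ) := by
      rintro ⟨h₃, h₄⟩
      rcases lt_or_gt_of_ne hl with h | h
      · have : k l.succ ≤ k j.castSucc := hk.monotone (by simpa [Fin.le_def] using h)
        omega
      · have : k j.succ ≤ k l.castSucc := hk.monotone (by simpa [Fin.le_def] using h)
        omega
    simp [piece, this]
  · simp

theorem blockMap_trunc {n m : ℕ} (a : Fin n → 𝕜) {k : Fin (m + 1) → ℕ} (hk : StrictMono k)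
    (b : Fin m → 𝕜) {t : ℕ} (ht : t ≤ m) :
    blockMap a k (trunc t b) = trunc (k ⟨t, by omega⟩) (blockMap a k b) := by
  ext i
  have key : ∀ j : Fin m, (trunc t b j • piece a k j) i =
      if (i : ℕ) < k ⟨t, by omega⟩ then (b j • piece a k j) i else 0 := by
    intro j
    by_cases hi : k j.castSucc ≤ (i : ℕ) ∧ (i : ℕ) < k j.succ
    · by_cases hj : (j : ℕ) < t
      · have : k j.succ ≤ k ⟨t, by omega⟩ := hk.monotone (by simpa [Fin.le_def] using hj)
        simp [trunc, hj, hi.2.trans_le this]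
      · have : k ⟨t, by omega⟩ ≤ k j.castSucc :=
          hk.monotone (by simpa [Fin.le_def] using hj)
        simp [trunc, hj, this.trans hi.1]
    · simp [piece, hi]
  rw [blockMap_apply, Finset.sum_apply, Finset.sum_congr rfl fun j _ => key j, trunc,
    blockMap_apply, Finset.sum_apply]
  split_ifs <;> simp

theorem MemB.comp_blockMap {ca cb : ℝ} {n m : ℕ} {P : SNPair 𝕜 n} (hP : MemB ca cb P)
    (a : Fin n → 𝕜) {k : Fin (m + 1) → ℕ} (hk : StrictMono k) (hkn : k (Fin.last m) ≤ n)
    (hnorm : ∀ j, P.1 (piece a k j) = 1) :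
    MemB ca cb ((P.1.comp (blockMap a k), P.2.comp (blockMap a k)) : SNPair 𝕜 m) where
  eq_zero_of b hb := by
    have h0 : blockMap a k b = 0 := hP.eq_zero_of _ hb
    ext j
    obtain ⟨i, hi⟩ : ∃ i, piece a k j i ≠ 0 := by
      by_contra! h
      have := hnorm j
      rw [show piece a k j = 0 from funext h, map_zero] at this
      exact zero_ne_one this
    by_cases hm : k j.castSucc ≤ (i : ℕ) ∧ (i : ℕ) < k j.succ
    · have h := blockMap_apply_of_mem a hk b hm.1 hm.2
      rw [h0] at h
      simp only [piece, hm, and_self, if_true] at hi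
      simpa [hi] using h.symm
    · simp [piece, hm] at hi
  single_eq_one j := by
    simpa [Seminorm.comp_apply, blockMap_single] using hnorm j
  trunc_fst t ht b := by
    simp only [Seminorm.comp_apply, blockMap_trunc a hk b ht]
    exact hP.trunc_fst _ ((hk.monotone (Fin.le_last _)).trans hkn) _
  trunc_snd t ht b := by
    simp only [Seminorm.comp_apply, blockMap_trunc a hk b ht]
    exact hP.trunc_snd _ ((hk.monotone (Fin.le_last _)).trans hkn) _
  snd_le b := hP.snd_le _

theorem StableFam.comp_blockMap_mem {ca cb : ℝ} {E : Fam 𝕜} (hE : StableFam ca cb E) {n m : ℕ}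
    {P : SNPair 𝕜 n} (hP : P ∈ E n) (a : Fin n → 𝕜) {k : Fin (m + 1) → ℕ} (h0 : k 0 = 0)
    (hk : StrictMono k) (hkn : k (Fin.last m) ≤ n) (hnorm : ∀ j, P.1 (piece a k j) = 1) :
    ((P.1.comp (blockMap a k), P.2.comp (blockMap a k)) : SNPair 𝕜 m) ∈ E m :=
  hE.2.2 n m P hP _ ((hE.1 n P hP).comp_blockMap a hk hkn hnorm)
    ⟨a, k, h0, hk, hkn, hnorm, fun _ => rfl, fun _ => rfl⟩

theorem lpnorm_nonneg (p : ℝ≥0∞) {n : ℕ} (a : Fin n → 𝕜) : 0 ≤ lpnorm p a := by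
  unfold lpnorm
  split_ifs
  · exact Real.iSup_nonneg fun _ => norm_nonneg _
  · positivity

theorem norm_le_lpnorm {p : ℝ≥0∞} (hp : 1 ≤ p) {n : ℕ} (a : Fin n → 𝕜) (i : Fin n) :
    ‖a i‖ ≤ lpnorm p a := by
  unfold lpnorm
  split_ifs with h
  · exact le_ciSup (f := fun i => ‖a i‖) (Set.finite_range _).bddAbove i
  · have hq : 0 < p.toReal := ENNReal.toReal_pos (zero_lt_one.trans_le hp).ne' h
    rw [one_div, Real.le_rpow_inv_iff_of_pos (norm_nonneg _) (by positivity) hq]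
    exact Finset.single_le_sum (f := fun i => ‖a i‖ ^ p.toReal)
      (fun _ _ => by positivity) (Finset.mem_univ i)

/-- Coordinatewise bounds by the `ℓ_p` norms of consecutive blocks give a bound by the whole
`ℓ_p` norm. -/
theorem lpnorm_le_mul_of_blocks {p : ℝ≥0∞} (hp : 1 ≤ p) {m n : ℕ} {S : ℝ} (hS : 0 ≤ S)
    (a : Fin (m * n) → 𝕜) (c : Fin m → 𝕜)
    (h : ∀ j, ‖c j‖ ≤ S * lpnorm p fun i => a (finProdFinEquiv (j, i))) :
    lpnorm p c ≤ S * lpnorm p a := by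
  by_cases hpt : p = ∞
  · subst hpt
    have h0 := mul_nonneg hS (lpnorm_nonneg ∞ a)
    have : lpnorm ∞ c = ⨆ j, ‖c j‖ := by simp [lpnorm]
    rw [this]
    refine Real.iSup_le (fun j => (h j).trans (mul_le_mul_of_nonneg_left ?_ hS)) h0
    have : lpnorm ∞ (fun i => a (finProdFinEquiv (j, i)))
        = ⨆ i, ‖a (finProdFinEquiv (j, i))‖ := by simp [lpnorm]
    rw [this]
    exact Real.iSup_le (fun i => norm_le_lpnorm hp a _) (lpnorm_nonneg _ _)
  · have hq : 0 < p.toReal := ENNReal.toReal_pos (zero_lt_one.trans_le hp).ne' hpt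
    simp only [lpnorm, hpt, if_false] at h ⊢
    rw [one_div] at *
    rw [Real.rpow_inv_le_iff_of_pos (by positivity) (by positivity) hq,
      Real.mul_rpow hS (by positivity), Real.rpow_inv_rpow (by positivity) hq.ne',
      ← finProdFinEquiv.sum_comp, Fintype.sum_prod_type, Finset.mul_sum]
    refine Finset.sum_le_sum fun j _ => ?_
    have := Real.rpow_le_rpow (norm_nonneg _) (h j) hq.le
    rwa [Real.mul_rpow hS (by positivity), Real.rpow_inv_rpow (by positivity) hq.ne'] at this

theorem SubB.alphaC_set_nonempty {ca cb : ℝ} (hca : 0 ≤ ca) {E : Fam 𝕜} (hE : SubB ca cb E)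
    {p : ℝ≥0∞} (hp : 1 ≤ p) (n : ℕ) :
    {T : ℝ | 0 < T ∧ ∀ P ∈ E n, ∀ a : Fin n → 𝕜, P.2 a ≤ T * lpnorm p a}.Nonempty := by
  refine ⟨ca * n + 1, by positivity, fun P hP a => ?_⟩
  have hB := hE n P hP
  have ha : a = ∑ i, a i • (Pi.single i 1 : Fin n → 𝕜) := by
    ext j
    simp [Finset.sum_apply, Pi.single_apply]
  have h1 : P.1 a ≤ n * lpnorm p a := by
    calc P.1 a = P.1 (∑ i, a i • (Pi.single i 1 : Fin n → 𝕜)) := by rw [← ha]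
      _ ≤ ∑ i, P.1 (a i • (Pi.single i 1 : Fin n → 𝕜)) :=
        Finset.le_sum_of_subadditive P.1 (map_zero P.1).le (map_add_le_add P.1) Finset.univ
          fun i => a i • (Pi.single i 1 : Fin n → 𝕜)
      _ ≤ ∑ _i : Fin n, lpnorm p a := Finset.sum_le_sum fun i _ => by
        rw [map_smul_eq_mul, hB.single_eq_one, mul_one]
        exact norm_le_lpnorm hp a i
      _ = n * lpnorm p a := by simp
  nlinarith [hB.snd_le a, lpnorm_nonneg p a, mul_le_mul_of_nonneg_left h1 hca]

theorem mem_piece_iff_of_equal_blocks {m n : ℕ} (j l : Fin m) (i : Fin n) :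
    (n * (j : ℕ) ≤ (finProdFinEquiv (l, i) : Fin (m * n)) ∧
      ((finProdFinEquiv (l, i) : Fin (m * n)) : ℕ) < n * (j + 1)) ↔ l = j := by
  simp only [finProdFinEquiv_apply_val, Fin.ext_iff]
  have hi := i.isLt
  constructor
  · rintro ⟨h₁, h₂⟩
    have h3 : (j : ℕ) < l + 1 := by
      by_contra! h
      have := Nat.mul_le_mul_left n h
      rw [mul_add] at this
      omega
    have h4 : (l : ℕ) < j + 1 := by
      by_contra! h
      have := Nat.mul_le_mul_left n h
      omega
    omega
  · intro h
    rw [h, mul_add]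
    omega

theorem piece_equal_blocks {m n : ℕ} (a : Fin (m * n) → 𝕜) (j l : Fin m) (i : Fin n) :
    piece a (fun j : Fin (m + 1) => n * (j : ℕ)) j (finProdFinEquiv (l, i)) =
      if l = j then a (finProdFinEquiv (l, i)) else 0 := by
  simp only [piece, Fin.val_castSucc, Fin.val_succ, mem_piece_iff_of_equal_blocks]

theorem sum_piece_equal_blocks {m n : ℕ} (a : Fin (m * n) → 𝕜) :
    ∑ j, piece a (fun j : Fin (m + 1) => n * (j : ℕ)) j = a := by
  ext t
  obtain ⟨⟨l, i⟩, rfl⟩ := finProdFinEquiv.surjective t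
  simp [Finset.sum_apply, piece_equal_blocks]

/-- Each equal-length piece of a vector is controlled by the constants valid for its length. -/
theorem StableFam.snd_piece_le {ca cb : ℝ} {E : Fam 𝕜} (hE : StableFam ca cb E) {p : ℝ≥0∞}
    {m n : ℕ} {S : ℝ} (hS : ∀ P ∈ E n, ∀ a : Fin n → 𝕜, P.2 a ≤ S * lpnorm p a)
    {P : SNPair 𝕜 (m * n)} (hP : P ∈ E (m * n)) (a : Fin (m * n) → 𝕜) (j : Fin m) :
    P.2 (piece a (fun j : Fin (m + 1) => n * (j : ℕ)) j) ≤
      S * lpnorm p fun i => a (finProdFinEquiv (j, i)) := by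
  set u : Fin (m * n) → 𝕜 := fun t => if n * (j : ℕ) ≤ t then 1 else 0 with hu
  set k : Fin (n + 1) → ℕ := fun i => if (i : ℕ) = 0 then 0 else n * j + i with hk
  have hpiece : ∀ i : Fin n, piece u k i = Pi.single (finProdFinEquiv (j, i)) 1 := by
    intro i
    ext t
    have ht : t = finProdFinEquiv (j, i) ↔ (t : ℕ) = i + n * j := by
      rw [Fin.ext_iff, finProdFinEquiv_apply_val]
    simp only [piece, hu, hk, Pi.single_apply, ht, Fin.val_castSucc, Fin.val_succ]
    split_ifs <;> first | rfl | (exfalso; omega)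
  have hmono : StrictMono k := by
    intro i l h
    have : (i : ℕ) < l := h
    simp only [hk]
    split_ifs <;> omega
  have hlast : k (Fin.last n) ≤ m * n := by
    have := Nat.mul_le_mul_left n (Nat.succ_le_of_lt j.isLt)
    rw [Nat.succ_eq_add_one, mul_add, mul_comm n m] at this
    simp only [hk, Fin.val_last]
    split_ifs <;> omega
  have hQ := hE.comp_blockMap_mem hP u (k := k) (by simp [hk]) hmono hlast fun i => by
    rw [hpiece]
    exact (hE.1 _ P hP).single_eq_one _
  have hsum : blockMap u k (fun i => a (finProdFinEquiv (j, i))) =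
      piece a (fun j : Fin (m + 1) => n * (j : ℕ)) j := by
    ext t
    obtain ⟨⟨l, i⟩, rfl⟩ := finProdFinEquiv.surjective t
    rw [piece_equal_blocks, blockMap_apply]
    simp only [hpiece, Finset.sum_apply, Pi.smul_apply, Pi.single_apply, smul_eq_mul,
      finProdFinEquiv.injective.eq_iff, Prod.mk.injEq]
    by_cases h : l = j <;> simp [h]
  rw [← hsum]
  exact hS _ hQ _

/-- Normalizing the equal-length pieces of a vector, with unit vectors in place of zero pieces. -/
theorem exists_normalized_pieces {ca cb : ℝ} {m n : ℕ} (hn : 1 ≤ n) {P : SNPair 𝕜 (m * n)}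
    (hP : MemB ca cb P) (a : Fin (m * n) → 𝕜) :
    ∃ u : Fin (m * n) → 𝕜, ∀ j : Fin m,
      P.1 (piece u (fun j : Fin (m + 1) => n * (j : ℕ)) j) = 1 ∧
      ((P.1 (piece a (fun j : Fin (m + 1) => n * (j : ℕ)) j) : ℝ) : 𝕜) •
        piece u (fun j : Fin (m + 1) => n * (j : ℕ)) j =
      piece a (fun j : Fin (m + 1) => n * (j : ℕ)) j := by
  set k : Fin (m + 1) → ℕ := fun j => n * (j : ℕ) with hk
  set w : Fin m → Fin (m * n) → 𝕜 := fun j =>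
    if P.1 (piece a k j) = 0 then Pi.single (finProdFinEquiv (j, ⟨0, hn⟩)) 1
    else ((P.1 (piece a k j) : ℝ) : 𝕜)⁻¹ • piece a k j with hw
  have hpiece : ∀ j, piece (fun t => w (finProdFinEquiv.symm t).1 t) k j = w j := by
    intro j
    ext t
    obtain ⟨⟨l, i⟩, rfl⟩ := finProdFinEquiv.surjective t
    rw [hk, piece_equal_blocks, Equiv.symm_apply_apply]
    by_cases h : l = j
    · simp [h]
    · simp only [h, if_false, hw]
      split_ifs
      · simp [h]
      · rw [Pi.smul_apply, hk, piece_equal_blocks, if_neg h, smul_zero]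
  refine ⟨fun t => w (finProdFinEquiv.symm t).1 t, fun j => ?_⟩
  rw [hpiece]
  by_cases h : P.1 (piece a k j) = 0
  · refine ⟨by simpa [hw, h] using hP.single_eq_one _, ?_⟩
    rw [h, hP.eq_zero_of _ h]
    simp
  · have h' : ((P.1 (piece a k j) : ℝ) : 𝕜) ≠ 0 := by exact_mod_cast h
    simp only [hw, h, if_false]
    refine ⟨?_, smul_inv_smul₀ h' _⟩
    rw [map_smul_eq_mul, norm_inv, RCLike.norm_ofReal, abs_of_nonneg (apply_nonneg _ _),
      inv_mul_cancel₀ h]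

theorem IdentityBlockFam.snd_le_mul {ca cb : ℝ} {E : Fam 𝕜} (hE : IdentityBlockFam ca cb E)
    {p : ℝ≥0∞} (hp : 1 ≤ p) {m n : ℕ} (hn : 1 ≤ n) {T S : ℝ} (hT0 : 0 ≤ T) (hS0 : 0 ≤ S)
    (hT : ∀ P ∈ E m, ∀ a : Fin m → 𝕜, P.2 a ≤ T * lpnorm p a)
    (hS : ∀ P ∈ E n, ∀ a : Fin n → 𝕜, P.2 a ≤ S * lpnorm p a)
    {P : SNPair 𝕜 (m * n)} (hP : P ∈ E (m * n)) (a : Fin (m * n) → 𝕜) :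
    P.2 a ≤ T * S * lpnorm p a := by
  obtain ⟨hst, hid⟩ := hE
  obtain ⟨u, hu⟩ := exists_normalized_pieces hn (hst.1 _ P hP) a
  set k : Fin (m + 1) → ℕ := fun j => n * (j : ℕ) with hk
  have hmono : StrictMono k := fun i j h => Nat.mul_lt_mul_of_pos_left h hn
  have hQ := hst.comp_blockMap_mem hP u (k := k) (by simp [hk]) hmono
    (by simp [hk, mul_comm]) fun j => (hu j).1
  set c : Fin m → 𝕜 := fun j => ((P.1 (piece a k j) : ℝ) : 𝕜) with hc
  have hsum : blockMap u k c = a := by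
    rw [blockMap_apply, Finset.sum_congr rfl fun j _ => (hu j).2, hk, sum_piece_equal_blocks]
  have hc_le : lpnorm p c ≤ S * lpnorm p a := by
    refine lpnorm_le_mul_of_blocks hp hS0 a c fun j => ?_
    rw [hc, RCLike.norm_ofReal, abs_of_nonneg (apply_nonneg _ _), hid _ P hP]
    exact hst.snd_piece_le hS hP a j
  calc P.2 a = P.2 (blockMap u k c) := by rw [hsum]
    _ ≤ T * lpnorm p c := hT _ hQ c
    _ ≤ T * (S * lpnorm p a) := mul_le_mul_of_nonneg_left hc_le hT0
    _ = T * S * lpnorm p a := (mul_assoc _ _ _).symm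

theorem le_csInf_mul_csInf {A B : Set ℝ} (hA : A.Nonempty) (hB : B.Nonempty)
    (hA0 : ∀ x ∈ A, 0 < x) (hB0 : ∀ x ∈ B, 0 < x) {z : ℝ}
    (h : ∀ x ∈ A, ∀ y ∈ B, z ≤ x * y) : z ≤ sInf A * sInf B := by
  have h1 : ∀ y ∈ B, z ≤ sInf A * y := fun y hy => by
    rw [← div_le_iff₀ (hB0 y hy)]
    exact le_csInf hA fun x hx => (div_le_iff₀ (hB0 y hy)).2 (h x hx y hy)
  rcases (Real.sInf_nonneg fun x hx => (hA0 x hx).le).eq_or_lt with h0 | h0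
  · obtain ⟨y, hy⟩ := hB
    simpa [← h0] using h1 y hy
  · rw [← div_le_iff₀' h0]
    exact le_csInf hB fun y hy => (div_le_iff₀' h0).2 (h1 y hy)

end

/-- Proposition `submP` for `α`: for an identity block
`E ⊆ ⋃_{n≥1} B_n^{a,b}` and any `1 ≤ p ≤ ∞`, the sequence `(α_{p,n}(E))_n` is
submultiplicative. -/
theorem alphaC_submultiplicative {𝕜 : Type*} [RCLike 𝕜]
    (ca cb : ℝ) (hca : 0 ≤ ca) (hcb : 1 ≤ cb)
    (E : Fam 𝕜) (hE : IdentityBlockFam ca cb E)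
    (p : ℝ≥0∞) (hp : 1 ≤ p) (m n : ℕ) (hm : 1 ≤ m) (hn : 1 ≤ n) :
    alphaC p E (m * n) ≤ alphaC p E m * alphaC p E n := by
  have hst := hE.1
  refine le_csInf_mul_csInf (hst.1.alphaC_set_nonempty hca hp m)
    (hst.1.alphaC_set_nonempty hca hp n) (fun _ h => h.1) (fun _ h => h.1)
    fun T hT S hS => csInf_le ⟨0, fun _ h => h.1.le⟩ ⟨mul_pos hT.1 hS.1, fun P hP a => ?_⟩
  exact hE.snd_le_mul hp hn hT.1.le hS.1.le hT.2 hS.2 hP a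

end AsymSeminorms
end
end

section
/- If (a_n)_{n=1}^∞ is a nondecreasing sequence of positive real numbers and C > 0 is such that a_{n²} ≤ C·a_n for every n ∈ ℕ, then there exist constants C₁ > 0 and λ > 0 such that a_n ≤ C₁·(log n)^λ for every n ≥ 2. -/
/-- Iterating `a (n ^ 2) ≤ D * a n` along the double powers of two. -/
lemma le_pow_mul_of_sq_le {a : ℕ → ℝ} {D : ℝ} (hD : 0 ≤ D)
    (h_sq : ∀ n : ℕ, 1 ≤ n → a (n ^ 2) ≤ D * a n) (k : ℕ) :
    a (2 ^ 2 ^ k) ≤ D ^ k * a 2 := by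
  induction k with
  | zero => simp
  | succ k ih =>
    calc a (2 ^ 2 ^ (k + 1)) = a ((2 ^ 2 ^ k) ^ 2) := by rw [pow_succ 2 k, pow_mul]
      _ ≤ D * a (2 ^ 2 ^ k) := h_sq _ Nat.one_le_two_pow
      _ ≤ D * (D ^ k * a 2) := by gcongr
      _ = D ^ (k + 1) * a 2 := by ring

/-- Every `n ≥ 2` lies between two consecutive double powers of two. -/
lemma exists_two_pow_two_pow_le_lt {n : ℕ} (hn : 2 ≤ n) :
    ∃ k : ℕ, 2 ^ 2 ^ k ≤ n ∧ n < 2 ^ 2 ^ (k + 1) := by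
  have hlog : Nat.log 2 n ≠ 0 := (Nat.log_pos one_lt_two hn).ne'
  refine ⟨Nat.log 2 (Nat.log 2 n), Nat.pow_le_of_le_log (by omega) ?_,
    Nat.lt_pow_of_log_lt one_lt_two ?_⟩
  · exact Nat.pow_log_le_self 2 hlog
  · exact Nat.lt_pow_succ_log_self one_lt_two _

/-- lemma of Enflo–Lindenstrauss–Pisier: if `(a_n)_{n≥1}` is a
nondecreasing sequence of positive reals and `C > 0` satisfies `a_{n²} ≤ C·a_n` for all
`n ≥ 1`, then there are constants `C₁, λ > 0` with `a_n ≤ C₁·(log n)^λ` for all `n ≥ 2`. -/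
theorem log_growth_of_square_bounded (a : ℕ → ℝ)
    (h_pos : ∀ n, 1 ≤ n → 0 < a n)
    (h_mono : ∀ m n : ℕ, 1 ≤ m → m ≤ n → a m ≤ a n)
    (C : ℝ) (hC : 0 < C) (h_sq : ∀ n : ℕ, 1 ≤ n → a (n ^ 2) ≤ C * a n) :
    ∃ C₁ : ℝ, 0 < C₁ ∧ ∃ lam : ℝ, 0 < lam ∧
      ∀ n : ℕ, 2 ≤ n → a n ≤ C₁ * Real.log n ^ lam := by
  have hD : 1 < C + 1 := by linarith
  have hD0 : 0 < C + 1 := by linarith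
  have h_sq' : ∀ n : ℕ, 1 ≤ n → a (n ^ 2) ≤ (C + 1) * a n := fun n hn => by
    linarith [h_sq n hn, h_pos n hn]
  have ha2 : 0 < a 2 := h_pos 2 one_le_two
  have hlog2 : 0 < Real.log 2 := Real.log_pos one_lt_two
  set lam := Real.logb 2 (C + 1)
  have hlam0 : 0 < lam := Real.logb_pos one_lt_two hD
  have h2lam : (2 : ℝ) ^ lam = C + 1 := Real.rpow_logb two_pos (by norm_num) hD0
  have hL : 0 < Real.log 2 ^ lam := Real.rpow_pos_of_pos hlog2 _
  refine ⟨(C + 1) * a 2 / Real.log 2 ^ lam, by positivity, lam, hlam0, fun n hn => ?_⟩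
  obtain ⟨k, hkn, hnk⟩ := exists_two_pow_two_pow_le_lt hn
  have hlogn : 2 ^ k * Real.log 2 ≤ Real.log n := by
    have h : ((2 : ℝ) ^ 2 ^ k) ≤ n := by exact_mod_cast hkn
    simpa [Real.log_pow] using Real.log_le_log (by positivity) h
  have hpow : (C + 1) ^ k * Real.log 2 ^ lam ≤ Real.log n ^ lam := by
    calc (C + 1) ^ k * Real.log 2 ^ lam = (2 ^ k * Real.log 2) ^ lam := by
          rw [Real.mul_rpow (by positivity) hlog2.le, ← h2lam, Real.rpow_pow_comm two_pos.le]
      _ ≤ Real.log n ^ lam := Real.rpow_le_rpow (by positivity) hlogn hlam0.le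
  calc a n ≤ a (2 ^ 2 ^ (k + 1)) := h_mono _ _ (by omega) hnk.le
    _ ≤ (C + 1) ^ (k + 1) * a 2 := le_pow_mul_of_sq_le hD0.le h_sq' _
    _ = (C + 1) * a 2 / Real.log 2 ^ lam * ((C + 1) ^ k * Real.log 2 ^ lam) := by
        rw [pow_succ]
        field_simp
    _ ≤ (C + 1) * a 2 / Real.log 2 ^ lam * Real.log n ^ lam := by gcongr
end

section
/- Let a ≥ 0, b ≥ 1 and let E ⊆ ⋃_{n≥1} B_n^{a,b} be an identity block. If N > 1 is an integer and 1 ≤ r ≤ q < ∞ are such that β_{r,N}(E) ≤ N^{1/r − 1/q}, then for every q < s < ∞ one has sup_n β_{s,n}(E) < ∞ (that is, E has block basic cotype s). -/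
open scoped BigOperators ENNReal

noncomputable section

namespace AsymSeminorms

variable {𝕜 : Type*} [RCLike 𝕜]

/-- The restriction of a coefficient vector to the coordinates in `[u, v)`. -/
def seg {n : ℕ} (u v : ℕ) (a : Fin n → 𝕜) : Fin n → 𝕜 :=
  fun i => if u ≤ (i : ℕ) ∧ (i : ℕ) < v then a i else 0

lemma seg_eq_trunc_sub {n u v : ℕ} (huv : u ≤ v) (a : Fin n → 𝕜) :
    seg u v a = trunc v a - trunc u a := by
  ext i
  simp only [seg, trunc, Pi.sub_apply]
  split_ifs <;> first | omega | simp

lemma seg_of_le {n u v : ℕ} (h : v ≤ u) (a : Fin n → 𝕜) : seg u v a = 0 := by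
  ext i
  simp only [seg, Pi.zero_apply]
  split_ifs <;> first | omega | rfl

lemma sum_seg {n : ℕ} (κ : ℕ → ℕ) (hκ : ∀ j, κ j ≤ κ (j + 1)) (a : Fin n → 𝕜) (M : ℕ) :
    ∑ j : Fin M, seg (κ j) (κ (j + 1)) a = seg (κ 0) (κ M) a := by
  rw [Fin.sum_univ_eq_sum_range (fun j => seg (κ j) (κ (j + 1)) a) M,
    seg_eq_trunc_sub (monotone_nat_of_le_succ hκ (Nat.zero_le M)),
    ← Finset.sum_range_sub (fun j => trunc (κ j) a)]
  exact Finset.sum_congr rfl fun j _ => seg_eq_trunc_sub (hκ j) a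

lemma MemB.seg_le {ca cb : ℝ} {n : ℕ} {P : SNPair 𝕜 n} (hP : MemB ca cb P) {u v : ℕ}
    (huv : u ≤ v) (hv : v ≤ n) (a : Fin n → 𝕜) : P.1 (seg u v a) ≤ 2 * cb * P.1 a := by
  rw [seg_eq_trunc_sub huv]
  have h := map_sub_le_add P.1 (trunc v a) (trunc u a)
  linarith [hP.trunc_fst v hv a, hP.trunc_fst u (huv.trans hv) a]

lemma MemB.norm_le_seg {ca cb : ℝ} {n : ℕ} {P : SNPair 𝕜 n} (hP : MemB ca cb P) (i : Fin n)
    {v : ℕ} (hv : (i : ℕ) < v) (a : Fin n → 𝕜) : ‖a i‖ ≤ cb * P.1 (seg i v a) := by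
  have h := hP.trunc_fst (i + 1) i.2 (seg i v a)
  have e : trunc ((i : ℕ) + 1) (seg i v a) = a i • (Pi.single i 1 : Fin n → 𝕜) := by
    ext l
    by_cases hl : l = i
    · subst hl
      simp [trunc, seg, hv]
    · have : (l : ℕ) ≠ i := fun h => hl (Fin.ext h)
      simp only [trunc, seg, Pi.smul_apply, Pi.single_eq_of_ne hl, smul_zero]
      split_ifs <;> first | omega | rfl
  rwa [e, map_smul_eq_mul, hP.single_eq_one, mul_one] at h

/-- The pair of seminorms on `𝕜^m` obtained from `P` by substituting the vectors `x j` for the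
basis vectors. -/
def substPair {n m : ℕ} (P : SNPair 𝕜 n) (x : Fin m → Fin n → 𝕜) : SNPair 𝕜 m :=
  (P.1.comp (Fintype.linearCombination 𝕜 x), P.2.comp (Fintype.linearCombination 𝕜 x))

lemma substPair_fst {n m : ℕ} (P : SNPair 𝕜 n) (x : Fin m → Fin n → 𝕜) (c : Fin m → 𝕜) :
    (substPair P x).1 c = P.1 (∑ j, c j • x j) := rfl

lemma substPair_snd {n m : ℕ} (P : SNPair 𝕜 n) (x : Fin m → Fin n → 𝕜) (c : Fin m → 𝕜) :
    (substPair P x).2 c = P.2 (∑ j, c j • x j) := rfl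

lemma sum_smul_piece_apply {n m : ℕ} {a : Fin n → 𝕜} {k : Fin (m + 1) → ℕ} (hk : StrictMono k)
    (c : Fin m → 𝕜) {j : Fin m} {i : Fin n} (h1 : k j.castSucc ≤ i) (h2 : (i : ℕ) < k j.succ) :
    (∑ l, c l • piece a k l) i = c j * a i := by
  rw [Finset.sum_apply, Finset.sum_eq_single j]
  · simp [piece, h1, h2]
  · intro l _ hl
    have : ¬ (k l.castSucc ≤ i ∧ (i : ℕ) < k l.succ) := by
      rintro ⟨h3, h4⟩
      rcases lt_or_gt_of_ne hl with h | h
      · have := hk.monotone (show l.succ ≤ j.castSucc from h)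
        omega
      · have := hk.monotone (show j.succ ≤ l.castSucc from h)
        omega
    simp [piece, this]
  · simp

lemma trunc_sum_smul_piece {n m : ℕ} {a : Fin n → 𝕜} {k : Fin (m + 1) → ℕ} (hk : StrictMono k)
    (c : Fin m → 𝕜) (l : ℕ) (hl : l < m + 1) :
    trunc (k ⟨l, hl⟩) (∑ j, c j • piece a k j) = ∑ j, trunc l c j • piece a k j := by
  have hz : ∀ i : Fin n, trunc (k ⟨l, hl⟩) (∑ j, c j • piece a k j) i =
      ∑ j, if (i : ℕ) < k ⟨l, hl⟩ then c j * piece a k j i else 0 := by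
    intro i
    simp only [trunc, Finset.sum_apply, Pi.smul_apply, smul_eq_mul]
    split_ifs <;> simp
  ext i
  rw [hz, Finset.sum_apply]
  refine Finset.sum_congr rfl fun j _ => ?_
  simp only [trunc, Pi.smul_apply, smul_eq_mul, piece]
  by_cases hjl : (j : ℕ) < l
  · have := hk.monotone (show j.succ ≤ ⟨l, hl⟩ from hjl)
    split_ifs <;> first | omega | simp
  · have := hk.monotone (show (⟨l, hl⟩ : Fin (m + 1)) ≤ j.castSucc from not_lt.1 hjl)
    split_ifs <;> first | omega | simp

lemma memB_substPair {ca cb : ℝ} {n m : ℕ} {P : SNPair 𝕜 n} (hP : MemB ca cb P)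
    {a : Fin n → 𝕜} {k : Fin (m + 1) → ℕ} (hk : StrictMono k) (hkn : k (Fin.last m) ≤ n)
    (h1 : ∀ j, P.1 (piece a k j) = 1) : MemB ca cb (substPair P (piece a k)) where
  eq_zero_of c hc := by
    have h := hP.eq_zero_of _ hc
    ext j
    by_contra hj
    refine one_ne_zero ((h1 j).symm.trans ?_)
    convert map_zero P.1
    ext i
    by_cases hi : k j.castSucc ≤ (i : ℕ) ∧ (i : ℕ) < k j.succ
    · have h2 := sum_smul_piece_apply (a := a) hk c hi.1 hi.2
      rw [show (∑ l, c l • piece a k l) = 0 from h] at h2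
      have : a i = 0 := (mul_eq_zero.1 h2.symm).resolve_left hj
      simp [piece, this]
    · simp [piece, hi]
  single_eq_one j := by
    rw [substPair_fst]
    simpa [Pi.single_apply] using h1 j
  trunc_fst l hl c := by
    rw [substPair_fst, substPair_fst, ← trunc_sum_smul_piece hk c l (Nat.lt_succ_of_le hl)]
    exact hP.trunc_fst _ ((hk.monotone (Fin.le_last _)).trans hkn) _
  trunc_snd l hl c := by
    rw [substPair_snd, substPair_snd, ← trunc_sum_smul_piece hk c l (Nat.lt_succ_of_le hl)]
    exact hP.trunc_snd _ ((hk.monotone (Fin.le_last _)).trans hkn) _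
  snd_le c := hP.snd_le _

lemma lpnorm_ofReal {r : ℝ} (hr : 0 ≤ r) {n : ℕ} (a : Fin n → 𝕜) :
    lpnorm (ENNReal.ofReal r) a = (∑ i, ‖a i‖ ^ r) ^ (1 / r) := by
  simp [lpnorm, ENNReal.toReal_ofReal hr]

lemma le_lpnorm_of_forall_le {r : ℝ} (hr : 0 < r) {n : ℕ} {δ : ℝ} (hδ : 0 ≤ δ) (a : Fin n → 𝕜)
    (h : ∀ i, δ ≤ ‖a i‖) : (n : ℝ) ^ (1 / r) * δ ≤ lpnorm (ENNReal.ofReal r) a := by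
  rw [lpnorm_ofReal hr.le]
  calc (n : ℝ) ^ (1 / r) * δ = (∑ _i : Fin n, δ ^ r) ^ (1 / r) := by
        rw [Finset.sum_const, Finset.card_univ, Fintype.card_fin, nsmul_eq_mul,
          Real.mul_rpow (by positivity) (by positivity), one_div, Real.rpow_rpow_inv hδ hr.ne']
    _ ≤ _ := by gcongr with i _; exact h i

lemma lpnorm_le_of_forall_le {r : ℝ} (hr : 0 < r) {n : ℕ} {δ : ℝ} (hδ : 0 ≤ δ) (a : Fin n → 𝕜)
    (h : ∀ i, ‖a i‖ ≤ δ) : lpnorm (ENNReal.ofReal r) a ≤ (n : ℝ) ^ (1 / r) * δ := by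
  rw [lpnorm_ofReal hr.le]
  calc _ ≤ (∑ _i : Fin n, δ ^ r) ^ (1 / r) := by gcongr with i _; exact h i
    _ = (n : ℝ) ^ (1 / r) * δ := by
        rw [Finset.sum_const, Finset.card_univ, Fintype.card_fin, nsmul_eq_mul,
          Real.mul_rpow (by positivity) (by positivity), one_div, Real.rpow_rpow_inv hδ hr.ne']

section IdentityBlock

variable {ca cb : ℝ} {E : Fam 𝕜}

lemma IdentityBlockFam.memB (hE : IdentityBlockFam ca cb E) {n : ℕ} {P : SNPair 𝕜 n}
    (hP : P ∈ E n) : MemB ca cb P := hE.1.1 n P hP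

lemma IdentityBlockFam.snd_single (hE : IdentityBlockFam ca cb E) {n : ℕ} {P : SNPair 𝕜 n}
    (hP : P ∈ E n) (i : Fin n) : P.2 (Pi.single i 1) = 1 := by
  rw [← hE.2 n P hP, (hE.memB hP).single_eq_one]

lemma IdentityBlockFam.norm_le (hE : IdentityBlockFam ca cb E) (hcb : 1 ≤ cb) {n : ℕ}
    {P : SNPair 𝕜 n} (hP : P ∈ E n) (a : Fin n → 𝕜) (i : Fin n) :
    ‖a i‖ ≤ 2 * cb ^ 2 * P.1 a := by
  have h1 := (hE.memB hP).norm_le_seg i i.2 a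
  have h2 := (hE.memB hP).seg_le i.2.le le_rfl a
  nlinarith

/-- For identity blocks the infimum defining `betaC` is attained. -/
lemma IdentityBlockFam.lpnorm_le_betaC_mul (hE : IdentityBlockFam ca cb E) (hcb : 1 ≤ cb)
    {r : ℝ} (hr : 0 < r) {n : ℕ} (hn : 0 < n) {P : SNPair 𝕜 n} (hP : P ∈ E n)
    (a : Fin n → 𝕜) :
    lpnorm (ENNReal.ofReal r) a ≤ betaC (ENNReal.ofReal r) E n * P.1 a := by
  have hmem : ∀ C ∈ {C : ℝ | 0 < C ∧ ∀ P ∈ E n, ∀ a : Fin n → 𝕜,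
      lpnorm (ENNReal.ofReal r) (fun i => a i * ((P.2 (Pi.single i 1) : ℝ) : 𝕜)) ≤ C * P.1 a},
      lpnorm (ENNReal.ofReal r) a ≤ C * P.1 a := by
    rintro C ⟨-, hC⟩
    simpa [hE.snd_single hP] using hC P hP a
  have hne : (n : ℝ) ^ (1 / r) * (2 * cb ^ 2) ∈ {C : ℝ | 0 < C ∧ ∀ P ∈ E n, ∀ a : Fin n → 𝕜,
      lpnorm (ENNReal.ofReal r) (fun i => a i * ((P.2 (Pi.single i 1) : ℝ) : 𝕜))
        ≤ C * P.1 a} := by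
    refine ⟨by positivity, fun Q hQ c => ?_⟩
    simp only [hE.snd_single hQ, RCLike.ofReal_one, mul_one]
    rw [mul_assoc]
    exact lpnorm_le_of_forall_le hr (by positivity) c (hE.norm_le hcb hQ c)
  rcases (apply_nonneg P.1 a).eq_or_lt with h0 | h0
  · simpa [← h0] using hmem _ hne
  · rw [← div_le_iff₀ h0]
    exact le_csInf ⟨_, hne⟩ fun C hC => (div_le_iff₀ h0).2 (hmem C hC)

/-- Lower estimate for a sum of `N` successive nonzero blocks. -/
lemma IdentityBlockFam.le_seg_of_forall_le (hE : IdentityBlockFam ca cb E) (hcb : 1 ≤ cb)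
    {N : ℕ} (hN : 0 < N) {r q : ℝ} (hr : 0 < r)
    (hβ : betaC (ENNReal.ofReal r) E N ≤ (N : ℝ) ^ (1 / r - 1 / q))
    {n : ℕ} {P : SNPair 𝕜 n} (hP : P ∈ E n) (a : Fin n → 𝕜) (κ : ℕ → ℕ)
    (hκ : Monotone κ) (hκn : ∀ j, κ j ≤ n) {δ : ℝ} (hδ : 0 < δ)
    (h : ∀ j < N, δ ≤ P.1 (seg (κ j) (κ (j + 1)) a)) :
    (N : ℝ) ^ (1 / q) * δ ≤ P.1 (seg (κ 0) (κ N) a) := by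
  set w : ℕ → ℝ := fun j => P.1 (seg (κ j) (κ (j + 1)) a) with hw
  have hw0 : ∀ j < N, 0 < w j := fun j hj => hδ.trans_le (h j hj)
  have hlt : ∀ j < N, κ j < κ (j + 1) := by
    intro j hj
    by_contra hc
    have := hw0 j hj
    simp [hw, seg_of_le (not_lt.1 hc)] at this
  let k : Fin (N + 1) → ℕ := fun j => if (j : ℕ) = 0 then 0 else κ j
  have hk_cast : ∀ j : Fin N, k j.castSucc = if (j : ℕ) = 0 then 0 else κ j := fun _ => rfl
  have hk_succ : ∀ j : Fin N, k j.succ = κ (j + 1) := fun j => by simp [k]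
  have hkm : StrictMono k := by
    refine Fin.strictMono_iff_lt_succ.2 fun j => ?_
    have := hlt j j.2
    rw [hk_cast, hk_succ]
    split_ifs <;> omega
  let a' : Fin n → 𝕜 := ∑ j : Fin N, ((w j : 𝕜)⁻¹) • seg (κ j) (κ (j + 1)) a
  have hpiece : ∀ j : Fin N, piece a' k j = ((w j : 𝕜)⁻¹) • seg (κ j) (κ (j + 1)) a := by
    intro j
    ext i
    simp only [piece, a', Finset.sum_apply, Pi.smul_apply, smul_eq_mul]
    have hz : ∀ l : Fin N, l ≠ j → k j.castSucc ≤ i → (i : ℕ) < k j.succ →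
        seg (κ l) (κ (l + 1)) a i = 0 := by
      intro l hl h1 h2
      rw [hk_cast] at h1
      rw [hk_succ] at h2
      have : ¬ (κ l ≤ i ∧ (i : ℕ) < κ (l + 1)) := by
        rintro ⟨h3, h4⟩
        have hl' : (l : ℕ) ≠ j := fun h => hl (Fin.ext h)
        rcases lt_or_gt_of_ne hl' with h | h
        · have := hκ (show (l : ℕ) + 1 ≤ j from h)
          split_ifs at h1 <;> omega
        · have := hκ (show (j : ℕ) + 1 ≤ l from h)
          split_ifs at h1 <;> omega
      simp [seg, this]
    split_ifs with hi
    · rw [Finset.sum_eq_single j]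
      · intro l _ hl
        rw [hz l hl hi.1 hi.2, mul_zero]
      · simp
    · have : ¬ (κ j ≤ i ∧ (i : ℕ) < κ (j + 1)) := by
        rintro ⟨h3, h4⟩
        rw [hk_cast, hk_succ] at hi
        split_ifs at hi <;> omega
      simp [seg, this]
  have hone : ∀ j : Fin N, P.1 (piece a' k j) = 1 := by
    intro j
    rw [hpiece, map_smul_eq_mul, norm_inv, RCLike.norm_ofReal, abs_of_pos (hw0 j j.2)]
    exact inv_mul_cancel₀ (hw0 j j.2).ne'
  have hlast : k (Fin.last N) ≤ n := by
    simp only [k, Fin.val_last]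
    split_ifs
    · omega
    · exact hκn N
  have hQ : substPair P (piece a' k) ∈ E N :=
    hE.1.2.2 n N P hP _ (memB_substPair (hE.memB hP) hkm hlast hone)
      ⟨a', k, by simp [k], hkm, hlast, hone, fun _ => rfl, fun _ => rfl⟩
  have h1 := hE.lpnorm_le_betaC_mul hcb hr hN hQ (fun j : Fin N => (w j : 𝕜))
  have h2 : (substPair P (piece a' k)).1 (fun j : Fin N => (w j : 𝕜))
      = P.1 (seg (κ 0) (κ N) a) := by
    rw [substPair_fst, ← sum_seg κ (fun j => hκ j.le_succ) a N]
    congr 1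
    refine Finset.sum_congr rfl fun j _ => ?_
    rw [hpiece, smul_smul, mul_inv_cancel₀, one_smul]
    exact_mod_cast (hw0 j j.2).ne'
  rw [h2] at h1
  have h3 := le_lpnorm_of_forall_le hr hδ.le (fun j : Fin N => (w j : 𝕜)) fun j => by
    rw [RCLike.norm_ofReal, abs_of_pos (hw0 j j.2)]
    exact h j j.2
  have h4 := h3.trans (h1.trans (mul_le_mul_of_nonneg_right hβ (apply_nonneg _ _)))
  have hN' : (0 : ℝ) < N := by exact_mod_cast hN
  have h5 : (N : ℝ) ^ (1 / r) = (N : ℝ) ^ (1 / r - 1 / q) * (N : ℝ) ^ (1 / q) := by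
    rw [← Real.rpow_add hN', sub_add_cancel]
  rw [h5, mul_assoc] at h4
  exact le_of_mul_le_mul_left h4 (by positivity)

/-- Lower estimate for a sum of `N ^ k` successive nonzero blocks. -/
lemma IdentityBlockFam.pow_mul_le_seg (hE : IdentityBlockFam ca cb E) (hcb : 1 ≤ cb)
    {N : ℕ} (hN : 0 < N) {r q : ℝ} (hr : 0 < r)
    (hβ : betaC (ENNReal.ofReal r) E N ≤ (N : ℝ) ^ (1 / r - 1 / q))
    {n : ℕ} {P : SNPair 𝕜 n} (hP : P ∈ E n) (a : Fin n → 𝕜) {δ : ℝ} (hδ : 0 < δ) (k : ℕ) :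
    ∀ κ : ℕ → ℕ, Monotone κ → (∀ j, κ j ≤ n) →
      (∀ j < N ^ k, δ ≤ P.1 (seg (κ j) (κ (j + 1)) a)) →
      ((N : ℝ) ^ (1 / q)) ^ k * δ ≤ P.1 (seg (κ 0) (κ (N ^ k)) a) := by
  induction k with
  | zero => intro κ _ _ h; simpa using h 0 (by simp)
  | succ k ih =>
    intro κ hκ hκn h
    have hN' : (0 : ℝ) < N := by exact_mod_cast hN
    have key := hE.le_seg_of_forall_le hcb hN hr hβ hP a (fun j => κ (j * N ^ k))
      (fun i j hij => hκ (Nat.mul_le_mul_right _ hij)) (fun j => hκn _)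
      (δ := ((N : ℝ) ^ (1 / q)) ^ k * δ) (by positivity) (fun j hj => by
        have := ih (fun i => κ (j * N ^ k + i)) (fun x y hxy => hκ (by omega)) (fun _ => hκn _)
          (fun i hi => h _ (by
            calc j * N ^ k + i < (j + 1) * N ^ k := by rw [add_mul]; omega
              _ ≤ N * N ^ k := Nat.mul_le_mul_right _ hj
              _ = N ^ (k + 1) := by ring))
        simpa [add_mul] using this)
    have e : N * N ^ k = N ^ (k + 1) := by ring
    simp only [zero_mul, e] at key
    calc _ = (N : ℝ) ^ (1 / q) * (((N : ℝ) ^ (1 / q)) ^ k * δ) := by ring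
      _ ≤ _ := key

/-- A weak `ℓ_q` estimate for the coefficients of a vector. -/
lemma IdentityBlockFam.card_mul_rpow_le (hE : IdentityBlockFam ca cb E) (hcb : 1 ≤ cb)
    {N : ℕ} (hN : 1 < N) {r q : ℝ} (hr : 0 < r) (hq : 0 < q)
    (hβ : betaC (ENNReal.ofReal r) E N ≤ (N : ℝ) ^ (1 / r - 1 / q))
    {n : ℕ} {P : SNPair 𝕜 n} (hP : P ∈ E n) (a : Fin n → 𝕜) {t : ℝ} (ht : 0 ≤ t)
    (T : Finset (Fin n)) (hT : ∀ i ∈ T, t ≤ ‖a i‖) :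
    T.card * t ^ q ≤ N * (2 * cb ^ 2 * P.1 a) ^ q := by
  have hPa : 0 ≤ P.1 a := apply_nonneg _ _
  rcases ht.eq_or_lt with rfl | ht
  · rw [Real.zero_rpow hq.ne', mul_zero]
    positivity
  rcases Nat.eq_zero_or_pos T.card with h0 | h0
  · rw [h0, Nat.cast_zero, zero_mul]
    positivity
  set m := T.card
  let κ : ℕ → ℕ := fun j => if h : j < m then (T.orderEmbOfFin rfl ⟨j, h⟩ : ℕ) else n
  have hκn : ∀ j, κ j ≤ n := by
    intro j
    simp only [κ]
    split_ifs
    · exact (Fin.is_lt _).le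
    · exact le_rfl
  have hκ : ∀ j < m, κ j < κ (j + 1) := by
    intro j hj
    simp only [κ, dif_pos hj]
    split_ifs
    · exact (T.orderEmbOfFin rfl).strictMono (by simp)
    · exact Fin.is_lt _
  have hκm : Monotone κ := by
    refine monotone_nat_of_le_succ fun j => ?_
    by_cases hj : j < m
    · exact (hκ j hj).le
    · simp [κ, hj, show ¬ j + 1 < m by omega]
  set k := Nat.log N m
  have hk1 : N ^ k ≤ m := Nat.pow_log_le_self N h0.ne'
  have hk2 : m < N ^ (k + 1) := Nat.lt_pow_succ_log_self hN m
  have hcb0 : 0 < cb := by linarith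
  have key := hE.pow_mul_le_seg hcb (by omega) hr hβ hP a (δ := t / cb) (by positivity) k κ hκm hκn
    (fun j hj => by
      have hj' : j < m := hj.trans_le hk1
      have h1 := (hE.memB hP).norm_le_seg (T.orderEmbOfFin rfl ⟨j, hj'⟩) (v := κ (j + 1))
        (by have := hκ j hj'; simpa only [κ, dif_pos hj'] using this) a
      have h2 := hT _ (T.orderEmbOfFin_mem rfl ⟨j, hj'⟩)
      rw [div_le_iff₀' hcb0]
      refine h2.trans (h1.trans_eq ?_)
      simp only [κ, dif_pos hj'])
  have key2 := key.trans ((hE.memB hP).seg_le (hκm (Nat.zero_le _)) (hκn _) a)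
  have key3 : ((N : ℝ) ^ (1 / q)) ^ k * t ≤ 2 * cb ^ 2 * P.1 a := by
    rw [← mul_div_assoc, div_le_iff₀ hcb0] at key2
    linarith
  have key4 := Real.rpow_le_rpow (by positivity) key3 hq.le
  have e : (((N : ℝ) ^ (1 / q)) ^ k) ^ q = (N : ℝ) ^ k := by
    rw [← Real.rpow_natCast, ← Real.rpow_natCast, ← Real.rpow_mul (by positivity),
      ← Real.rpow_mul (by positivity)]
    congr 1
    field_simp
  rw [Real.mul_rpow (by positivity) ht.le, e] at key4
  have hmN : (m : ℝ) ≤ N * (N : ℝ) ^ k := by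
    rw [← pow_succ']
    exact_mod_cast hk2.le
  calc (m : ℝ) * t ^ q ≤ N * (N : ℝ) ^ k * t ^ q := by gcongr
    _ = N * ((N : ℝ) ^ k * t ^ q) := by ring
    _ ≤ _ := by gcongr

end IdentityBlock

/-- Weak `ℓ_q` embeds into `ℓ_s` for `q < s`. -/
lemma sum_rpow_le_of_card_mul_rpow_le {ι : Type*} [DecidableEq ι] {f : ι → ℝ} (hf : ∀ i, 0 ≤ f i)
    {q s A : ℝ} (hq : 0 < q) (hs : 0 < s)
    (h : ∀ (T : Finset ι) (t : ℝ), 0 ≤ t → (∀ i ∈ T, t ≤ f i) → T.card * t ^ q ≤ A)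
    (T : Finset ι) :
    ∑ i ∈ T, f i ^ s ≤ A ^ (s / q) * ∑ j ∈ Finset.range T.card, 1 / ((j + 1 : ℕ) : ℝ) ^ (s / q) := by
  induction T using Finset.induction_on_min_value f with
  | empty => simp
  | insert i T hi hle ih =>
    rw [Finset.sum_insert hi, Finset.card_insert_of_notMem hi, Finset.sum_range_succ, mul_add,
      add_comm]
    refine add_le_add ih ?_
    have h1 := h (insert i T) (f i) (hf i) (by simpa using hle)
    rw [Finset.card_insert_of_notMem hi] at h1
    have hc : (0 : ℝ) < ((T.card + 1 : ℕ) : ℝ) := by positivity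
    have h2 := Real.rpow_le_rpow (mul_nonneg hc.le (Real.rpow_nonneg (hf i) q)) h1
      (div_pos hs hq).le
    rw [Real.mul_rpow hc.le (Real.rpow_nonneg (hf i) q), ← Real.rpow_mul (hf i),
      mul_div_cancel₀ s hq.ne'] at h2
    rw [mul_one_div, le_div_iff₀ (by positivity), mul_comm]
    exact h2

end AsymSeminorms

namespace AsymSeminorms

/-- Proposition 2.7(iii): if `E` is an identity block, `N > 1` and
`1 ≤ r ≤ q < ∞` satisfy `β_{r,N}(E) ≤ N^{1/r − 1/q}`, then `E` has block basic cotype `s`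
for every `q < s < ∞`, i.e. `sup_n β_{s,n}(E) < ∞`. -/
theorem block_basic_cotype_of_beta_bound {𝕜 : Type*} [RCLike 𝕜]
    (ca cb : ℝ) (hca : 0 ≤ ca) (hcb : 1 ≤ cb)
    (E : Fam 𝕜) (hE : IdentityBlockFam ca cb E)
    (N : ℕ) (hN : 1 < N) (r q : ℝ) (hr : 1 ≤ r) (hrq : r ≤ q)
    (hβ : betaC (ENNReal.ofReal r) E N ≤ (N : ℝ) ^ (1 / r - 1 / q)) :
    ∀ s : ℝ, q < s →
      ∃ C : ℝ, ∀ n : ℕ, 1 ≤ n → betaC (ENNReal.ofReal s) E n ≤ C := by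
  intro s hqs
  have hr0 : 0 < r := by linarith
  have hq0 : 0 < q := by linarith
  have hs0 : 0 < s := by linarith
  have hsum : Summable fun j : ℕ => 1 / ((j + 1 : ℕ) : ℝ) ^ (s / q) :=
    (summable_nat_add_iff 1).2 (Real.summable_one_div_nat_rpow.2 ((one_lt_div hq0).2 hqs))
  set Z := ∑' j : ℕ, 1 / ((j + 1 : ℕ) : ℝ) ^ (s / q)
  have hZ0 : 0 < Z := hsum.tsum_pos (fun j => by positivity) 0 (by simp)
  have hN0 : (0 : ℝ) < N := by exact_mod_cast (by omega : 0 < N)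
  refine ⟨(N : ℝ) ^ (1 / q) * Z ^ (1 / s) * (2 * cb ^ 2), fun n _ =>
    csInf_le ⟨0, fun C hC => hC.1.le⟩ ⟨by positivity, fun P hP a => ?_⟩⟩
  simp only [hE.snd_single hP, RCLike.ofReal_one, mul_one]
  have hK : 0 ≤ 2 * cb ^ 2 * P.1 a := mul_nonneg (by positivity) (apply_nonneg _ _)
  set K := 2 * cb ^ 2 * P.1 a with hKdef
  have h1 := sum_rpow_le_of_card_mul_rpow_le (f := fun i => ‖a i‖) (fun i => norm_nonneg _) hq0 hs0
    (A := N * K ^ q)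
    (fun T t ht hT => hE.card_mul_rpow_le hcb hN hr0 hq0 hβ hP a ht T hT) Finset.univ
  have h2 : ∑ i, ‖a i‖ ^ s ≤ (N * K ^ q) ^ (s / q) * Z :=
    h1.trans (mul_le_mul_of_nonneg_left
      (hsum.sum_le_tsum _ fun j _ => by positivity) (by positivity))
  rw [lpnorm_ofReal hs0.le]
  calc (∑ i, ‖a i‖ ^ s) ^ (1 / s) ≤ ((N * K ^ q) ^ (s / q) * Z) ^ (1 / s) := by gcongr
    _ = (N : ℝ) ^ (1 / q) * K * Z ^ (1 / s) := by
        rw [Real.mul_rpow (by positivity) hZ0.le, ← Real.rpow_mul (by positivity),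
          show s / q * (1 / s) = 1 / q by field_simp, Real.mul_rpow hN0.le (by positivity),
          ← Real.rpow_mul hK, mul_one_div_cancel hq0.ne', Real.rpow_one]
    _ = _ := by rw [hKdef]; ring

end AsymSeminorms
end
end
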